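/- arXiv:2207.01957 — 2 statements merged into one kernel-verified Lean document; each statement's English description precedes it below -/
import Mathlib

section
/- Let ω and ρ be states on a unital C*-algebra A. Then ρ lies in the weak* closure of the set ω∘E(A) = {ω∘φ : φ ∈ E(A)} if and only if ‖ρ|J‖ ≤ ‖ω|J‖ for every closed two-sided ideal J of A. -/
universe u

open scoped ComplexConjugate ComplexOrder

noncomputable section

variable {A : Type u} [NormedRing A] [StarRing A] [CStarRing A]
  [NormedAlgebra ℂ A] [StarModule ℂ A] [CompleteSpace A]

/-- A linear functional on a C*-algebra is positive if it is nonnegative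
on all elements of the form `a* a`. -/
def IsPositiveFunctional (ω : A →L[ℂ] ℂ) : Prop :=
  ∀ a : A, 0 ≤ ω (star a * a)

/-- A state is a positive unital linear functional. -/
def IsState (ω : A →L[ℂ] ℂ) : Prop :=
  IsPositiveFunctional ω ∧ ω 1 = 1

/-- A hermitian (self-adjoint) linear functional. -/
def IsHermitianFunctional (ω : A →L[ℂ] ℂ) : Prop :=
  ∀ a : A, ω (star a) = conj (ω a)

/-- `ωp`, `ωm` form the Jordan decomposition of the hermitian functional `ω`. -/
def IsJordanDecomposition (ω ωp ωm : A →L[ℂ] ℂ) : Prop :=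
  IsPositiveFunctional ωp ∧ IsPositiveFunctional ωm ∧ ω = ωp - ωm ∧ ‖ω‖ = ‖ωp‖ + ‖ωm‖

/-- An element of a C*-algebra is positive iff it is of the form `b* b`. -/
def IsPositiveElem (c : A) : Prop :=
  ∃ b : A, c = star b * b

/-- `E(A)`: the unital completely positive elementary maps
`x ↦ ∑ i, (a i)* x (a i)` with `∑ i, (a i)* (a i) = 1`. -/
def IsElementaryUCP (φ : A →L[ℂ] A) : Prop :=
  ∃ (n : ℕ) (a : Fin n → A), (∑ i, star (a i) * a i) = 1 ∧
    ∀ x : A, φ x = ∑ i, star (a i) * x * a i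

/-- The set `ω ∘ E(A) = {ω ∘ φ : φ ∈ E(A)}`. -/
def mixSet (ω : A →L[ℂ] ℂ) : Set (A →L[ℂ] ℂ) :=
  {ρ | ∃ φ : A →L[ℂ] A, IsElementaryUCP φ ∧ ρ = ω.comp φ}

/-- Membership in the weak* closure of a set of functionals: every basic weak*
neighbourhood of `ρ` (given by finitely many points and `ε > 0`) meets `S`. -/
def InWeakStarClosure (S : Set (A →L[ℂ] ℂ)) (ρ : A →L[ℂ] ℂ) : Prop :=
  ∀ ε : ℝ, 0 < ε → ∀ (n : ℕ) (x : Fin n → A), ∃ σ ∈ S, ∀ i, ‖ρ (x i) - σ (x i)‖ < ε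

/-- Norm-closed two-sided ideals (which in a C*-algebra are automatically
`*`-closed `ℂ`-submodules). -/
def IsClosedIdeal (J : Set A) : Prop :=
  IsClosed J ∧ (0 : A) ∈ J ∧ (∀ x ∈ J, ∀ y ∈ J, x + y ∈ J) ∧
    (∀ (c : ℂ), ∀ x ∈ J, c • x ∈ J) ∧ (∀ (a : A), ∀ x ∈ J, a * x ∈ J ∧ x * a ∈ J)

/-- The norm `‖ω|J‖` of the restriction of a functional `ω` to a subset `J`. -/
def normRestrict (ω : A →L[ℂ] ℂ) (J : Set A) : ℝ :=
  sSup {r : ℝ | ∃ x ∈ J, ‖x‖ ≤ 1 ∧ r = ‖ω x‖}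

/-- The norm `‖cω‖` of the functional `x ↦ ω (c * x)`. -/
def mulNorm (ω : A →L[ℂ] ℂ) (c : A) : ℝ :=
  sSup {r : ℝ | ∃ x : A, ‖x‖ ≤ 1 ∧ r = ‖ω (c * x)‖}

/-- A state `ω` is maximally mixed if every state `ρ` that is more mixed than `ω`
(i.e. `ρ` lies in the weak* closure of `ω ∘ E(A)`) satisfies in turn that `ω` is
more mixed than `ρ`. -/
def IsMaximallyMixed (ω : A →L[ℂ] ℂ) : Prop :=
  IsState ω ∧ ∀ ρ : A →L[ℂ] ℂ, IsState ρ →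
    InWeakStarClosure (mixSet ω) ρ → InWeakStarClosure (mixSet ρ) ω

/-- Maximal (norm-closed two-sided) ideals. -/
def IsMaximalIdeal (N : Set A) : Prop :=
  IsClosedIdeal N ∧ N ≠ Set.univ ∧
    ∀ N' : Set A, IsClosedIdeal N' → N' ≠ Set.univ → N ⊆ N' → N' = N

/-- The strong radical: the intersection of all maximal ideals. -/
def strongRadical (A : Type u) [NormedRing A] [StarRing A] [CStarRing A]
    [NormedAlgebra ℂ A] [StarModule ℂ A] [CompleteSpace A] : Set A :=
  ⋂₀ {N : Set A | IsMaximalIdeal N}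

section Helpers

set_option linter.unusedSectionVars false

variable {B : Type*} [CStarAlgebra B] [PartialOrder B] [StarOrderedRing B]

lemma smul_one_nonneg' {r : ℝ} (hr : 0 ≤ r) : (0 : B) ≤ r • (1 : B) := smul_nonneg hr zero_le_one

lemma cfc_mul_eq_one {b : B} (hb : IsSelfAdjoint b) (f k : ℝ → ℝ)
    (hf : ContinuousOn f (spectrum ℝ b)) (hk : ContinuousOn k (spectrum ℝ b))
    (h : ∀ s ∈ spectrum ℝ b, f s * k s = 1) : cfc f b * cfc k b = 1 := by
  rw [← cfc_mul f k b hf hk, ← cfc_one ℝ b]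
  exact cfc_congr fun s hs => by simpa using h s hs

lemma key_approx {x h : B} (hx : IsSelfAdjoint x) (hx1 : x ≤ 1) (hh : 0 ≤ h) {κ : ℝ} (hκ : 0 < κ)
    (hxh : x * x ≤ h + (κ ^ 3) • (1 : B)) :
    ∃ g : B, IsSelfAdjoint g ∧ g * h * g ≤ 1 ∧ x ≤ g * h * g + (2 * κ) • (1 : B) := by
  have hha : IsSelfAdjoint h := IsSelfAdjoint.of_nonneg hh
  have hsp : ∀ s ∈ spectrum ℝ h, 0 ≤ s := fun s hs => spectrum_nonneg_of_nonneg hh hs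
  have hsx : ∀ s ∈ spectrum ℝ x, s ≤ 1 := by
    have := (le_algebraMap_iff_spectrum_le (r := (1 : ℝ)) (a := x) hx).1 (by simpa using hx1)
    exact this
  set m : ℝ := κ ^ 3 + κ ^ 2 with hm
  have hmpos : 0 < m := by positivity
  have hpos : ∀ s ∈ spectrum ℝ h, 0 < s + m := fun s hs => by have := hsp s hs; linarith
  have hne : ∀ s ∈ spectrum ℝ h, s + m ≠ 0 := fun s hs => (hpos s hs).ne'
  have hsne : ∀ s ∈ spectrum ℝ h, √(s + m) ≠ 0 := fun s hs => (Real.sqrt_pos.2 (hpos s hs)).ne'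
  have hxne : ∀ s : ℝ, s * s + κ ^ 2 ≠ 0 := fun s => by nlinarith [mul_self_nonneg s, pow_pos hκ 2]
  have c1 : ContinuousOn (fun s : ℝ => (√(s + m))⁻¹) (spectrum ℝ h) :=
    ContinuousOn.inv₀ (by fun_prop) hsne
  have c2 : ContinuousOn (fun s : ℝ => (s + m)⁻¹) (spectrum ℝ h) :=
    ContinuousOn.inv₀ (by fun_prop) hne
  have c3 : ContinuousOn (fun s : ℝ => (s * s + κ ^ 2)⁻¹) (spectrum ℝ x) :=
    ContinuousOn.inv₀ (by fun_prop) (fun s _ => hxne s)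
  set g : B := cfc (fun s : ℝ => (√(s + m))⁻¹) h with hg
  set Yi : B := cfc (fun s : ℝ => (s + m)⁻¹) h with hYi
  set Ui : B := cfc (fun s : ℝ => (s * s + κ ^ 2)⁻¹) x with hUi
  have hY : h + m • (1 : B) = cfc (fun s : ℝ => s + m) h := by
    rw [cfc_add_const m (fun s : ℝ => s) h, cfc_id' ℝ h, Algebra.algebraMap_eq_smul_one]
  have hU : x * x + (κ ^ 2) • (1 : B) = cfc (fun s : ℝ => s * s + κ ^ 2) x := by
    rw [cfc_add_const (κ ^ 2) (fun s : ℝ => s * s) x, cfc_mul (fun s : ℝ => s) (fun s : ℝ => s) x,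
      cfc_id' ℝ x, Algebra.algebraMap_eq_smul_one]
  have hY1 : (h + m • (1 : B)) * Yi = 1 := by
    rw [hY, hYi]
    exact cfc_mul_eq_one hha _ _ (by fun_prop) c2 fun s hs => mul_inv_cancel₀ (hne s hs)
  have hY2 : Yi * (h + m • (1 : B)) = 1 := by
    rw [hY, hYi]
    exact cfc_mul_eq_one hha _ _ c2 (by fun_prop) fun s hs => inv_mul_cancel₀ (hne s hs)
  have hU1 : (x * x + (κ ^ 2) • (1 : B)) * Ui = 1 := by
    rw [hU, hUi]
    exact cfc_mul_eq_one hx _ _ (by fun_prop) c3 fun s hs => mul_inv_cancel₀ (hxne s)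
  have hU2 : Ui * (x * x + (κ ^ 2) • (1 : B)) = 1 := by
    rw [hU, hUi]
    exact cfc_mul_eq_one hx _ _ c3 (by fun_prop) fun s hs => inv_mul_cancel₀ (hxne s)
  let Y : Bˣ := ⟨_, _, hY1, hY2⟩
  let U : Bˣ := ⟨_, _, hU1, hU2⟩
  have hxx : 0 ≤ x * x := by simpa [hx.star_eq] using star_mul_self_nonneg x
  have hinv : Yi ≤ Ui := by
    refine CStarAlgebra.inv_le_inv (a := U) (b := Y) ?_ ?_
    · exact add_nonneg hxx (smul_one_nonneg' (by positivity))
    · change x * x + (κ ^ 2) • (1 : B) ≤ h + m • (1 : B)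
      rw [hm, add_smul, ← add_assoc]
      gcongr
  have hd : g * h * g = 1 - m • Yi := by
    have e1 : g * h * g = cfc (fun s : ℝ => (√(s + m))⁻¹ * s * (√(s + m))⁻¹) h := by
      rw [cfc_mul (fun s : ℝ => (√(s + m))⁻¹ * s) (fun s : ℝ => (√(s + m))⁻¹) h
        (c1.mul continuousOn_id) c1,
        cfc_mul (fun s : ℝ => (√(s + m))⁻¹) (fun s : ℝ => s) h c1 continuousOn_id, cfc_id' ℝ h]
    have e2 : 1 - m • Yi = cfc (fun s : ℝ => 1 - m • (s + m)⁻¹) h := by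
      rw [cfc_sub (fun _ : ℝ => (1 : ℝ)) (fun s : ℝ => m • (s + m)⁻¹) h
        continuousOn_const (c2.const_smul m), cfc_const_one ℝ h,
        cfc_smul m (fun s : ℝ => (s + m)⁻¹) h c2]
    rw [e1, e2]
    refine cfc_congr fun s hs => ?_
    have h1 := hpos s hs
    have h2 := Real.mul_self_sqrt h1.le
    have : (√(s + m))⁻¹ * s * (√(s + m))⁻¹ = s * (√(s + m) * √(s + m))⁻¹ := by
      rw [mul_inv]; ring
    simp only [this, h2, smul_eq_mul]
    field_simp
    ring
  have hYi0 : 0 ≤ Yi := cfc_nonneg fun s hs => (inv_pos.2 (hpos s hs)).le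
  have hYi1 : Yi ≤ (m⁻¹) • (1 : B) := by
    rw [← Algebra.algebraMap_eq_smul_one]
    refine cfc_le_algebraMap _ _ _ (fun s hs => ?_) c2
    exact inv_anti₀ hmpos (by linarith [hsp s hs])
  have hxU : x ≤ (1 + κ) • (1 : B) - (κ ^ 2) • Ui := by
    have e2 : (1 + κ) • (1 : B) - (κ ^ 2) • Ui
        = cfc (fun s : ℝ => (1 + κ) - (κ ^ 2) • (s * s + κ ^ 2)⁻¹) x := by
      rw [cfc_sub (fun _ : ℝ => (1 + κ : ℝ)) (fun s : ℝ => (κ ^ 2) • (s * s + κ ^ 2)⁻¹) x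
        continuousOn_const (c3.const_smul (κ ^ 2)),
        cfc_const (1 + κ) x, cfc_smul (κ ^ 2) (fun s : ℝ => (s * s + κ ^ 2)⁻¹) x c3,
        Algebra.algebraMap_eq_smul_one]
    rw [e2]
    conv_lhs => rw [← cfc_id' ℝ x]
    refine cfc_mono (fun s hs => ?_) continuousOn_id
      (continuousOn_const.sub (c3.const_smul (κ ^ 2)))
    have h1 := hsx s hs
    have h2 : 0 < s * s + κ ^ 2 := by nlinarith [mul_self_nonneg s, pow_pos hκ 2]
    rw [smul_eq_mul, le_sub_iff_add_le, ← le_sub_iff_add_le', ← div_eq_mul_inv, div_le_iff₀ h2]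
    nlinarith [mul_nonneg (sub_nonneg.2 h1) (mul_self_nonneg s),
      mul_nonneg hκ.le (sq_nonneg (s - κ / 2)), pow_pos hκ 3]
  refine ⟨g, cfc_predicate _ h, ?_, ?_⟩
  · rw [hd]
    exact sub_le_self _ (smul_nonneg hmpos.le hYi0)
  · rw [hd]
    calc x ≤ (1 + κ) • (1 : B) - (κ ^ 2) • Ui := hxU
      _ ≤ (1 + κ) • (1 : B) - (κ ^ 2) • Yi := by gcongr
      _ = (1 - m • Yi) + κ • (1 : B) + (κ ^ 3) • Yi := by
        rw [hm]; module
      _ ≤ (1 - m • Yi) + κ • (1 : B) + (κ ^ 3) • ((m⁻¹) • (1 : B)) := by gcongr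
      _ ≤ (1 - m • Yi) + κ • (1 : B) + κ • (1 : B) := by
        rw [smul_smul]
        have : κ ^ 3 * m⁻¹ ≤ κ := by
          rw [← div_eq_mul_inv, div_le_iff₀ hmpos, hm]
          nlinarith [pow_pos hκ 4]
        gcongr
      _ = (1 - m • Yi) + (2 * κ) • (1 : B) := by module

def Gm (a : B) : AddSubmonoid (B × B) :=
  AddSubmonoid.closure (Set.range fun c : B => (star c * c, star c * a * c))

def It (a : B) (t : ℝ) : Set B := {d | ∃ T, (d, T) ∈ Gm a ∧ t • d ≤ T}

def Kt (a : B) (t : ℝ) : Set B :=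
  {z | (∃ h ∈ It a t, star z * z ≤ h) ∧ ∃ h ∈ It a t, z * star z ≤ h}

lemma Gm_gen (a c : B) : (star c * c, star c * a * c) ∈ Gm a :=
  AddSubmonoid.subset_closure ⟨c, rfl⟩

lemma Gm_conj {a : B} {p : B × B} (hp : p ∈ Gm a) (b : B) :
    (star b * p.1 * b, star b * p.2 * b) ∈ Gm a := by
  induction hp using AddSubmonoid.closure_induction with
  | mem x hx =>
    obtain ⟨c, rfl⟩ := hx
    have := Gm_gen a (c * b)
    simpa [mul_assoc] using this
  | zero => 
    have h := (Gm a).zero_mem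
    rw [Prod.zero_eq_mk] at h
    simpa only [Prod.fst_zero, Prod.snd_zero, mul_zero, zero_mul] using h
  | add x y _ _ h1 h2 =>
    have := (Gm a).add_mem h1 h2
    simpa [mul_add, add_mul] using this

lemma Gm_nonneg {a : B} {p : B × B} (hp : p ∈ Gm a) : 0 ≤ p.1 := by
  induction hp using AddSubmonoid.closure_induction with
  | mem x hx =>
    obtain ⟨c, rfl⟩ := hx
    exact star_mul_self_nonneg c
  | zero => exact le_rfl
  | add x y _ _ h1 h2 => exact add_nonneg h1 h2

lemma Gm_fin {a : B} {p : B × B} (hp : p ∈ Gm a) :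
    ∃ (n : ℕ) (c : Fin n → B), p.1 = ∑ i, star (c i) * c i ∧ p.2 = ∑ i, star (c i) * a * c i := by
  induction hp using AddSubmonoid.closure_induction with
  | mem x hx =>
    obtain ⟨c, rfl⟩ := hx
    exact ⟨1, fun _ => c, by simp, by simp⟩
  | zero => exact ⟨0, fun _ => 0, by simp, by simp⟩
  | add x y _ _ h1 h2 =>
    obtain ⟨n, c, h1, h1'⟩ := h1
    obtain ⟨m, e, h2, h2'⟩ := h2
    refine ⟨n + m, Fin.append c e, ?_, ?_⟩ <;> simp [Fin.sum_univ_add, h1, h1', h2, h2']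

lemma It_nonneg {a d : B} {t : ℝ} (hd : d ∈ It a t) : 0 ≤ d := by
  obtain ⟨T, h, _⟩ := hd
  exact Gm_nonneg h

lemma It_add {a d e : B} {t : ℝ} (hd : d ∈ It a t) (he : e ∈ It a t) : d + e ∈ It a t := by
  obtain ⟨T, h, h'⟩ := hd
  obtain ⟨S, k, k'⟩ := he
  exact ⟨T + S, (Gm a).add_mem h k, by rw [smul_add]; exact add_le_add h' k'⟩

lemma It_conj {a d : B} {t : ℝ} (hd : d ∈ It a t) (b : B) : star b * d * b ∈ It a t := by
  obtain ⟨T, h, h'⟩ := hd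
  refine ⟨_, Gm_conj h b, ?_⟩
  have := star_left_conjugate_le_conjugate h' b
  simpa using this

lemma It_smul {a d : B} {t r : ℝ} (hr : 0 ≤ r) (hd : d ∈ It a t) : r • d ∈ It a t := by
  have := It_conj hd ((√r) • (1 : B))
  simpa [smul_smul, Real.mul_self_sqrt hr] using this

lemma It_mono {a : B} {t t' : ℝ} (h : t' ≤ t) : It a t ⊆ It a t' := by
  rintro d ⟨T, hT, hT'⟩
  refine ⟨T, hT, le_trans ?_ hT'⟩
  have := Gm_nonneg hT
  exact smul_le_smul_of_nonneg_right h this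

lemma Kt_mono {a : B} {t t' : ℝ} (h : t' ≤ t) : Kt a t ⊆ Kt a t' := by
  rintro d ⟨⟨x, hx, hx'⟩, ⟨y, hy, hy'⟩⟩
  exact ⟨⟨x, It_mono h hx, hx'⟩, ⟨y, It_mono h hy, hy'⟩⟩

lemma Kt_zero (a : B) (t : ℝ) : (0 : B) ∈ Kt a t := by
  have : (0 : B) ∈ It a t := ⟨0, (Gm a).zero_mem, by simp⟩
  exact ⟨⟨0, this, by simp⟩, ⟨0, this, by simp⟩⟩

lemma add_star_sq_le (z w : B) : star (z + w) * (z + w) ≤ (2 : ℝ) • (star z * z + star w * w) := by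
  have := star_mul_self_nonneg (z - w)
  rw [← sub_nonneg]
  convert this using 1
  simp only [star_add, star_sub, two_smul]
  noncomm_ring

lemma Kt_star {a z : B} {t : ℝ} (hz : z ∈ Kt a t) : star z ∈ Kt a t := by
  obtain ⟨h1, h2⟩ := hz
  exact ⟨by simpa using h2, by simpa using h1⟩

lemma Kt_add {a z w : B} {t : ℝ} (hz : z ∈ Kt a t) (hw : w ∈ Kt a t) : z + w ∈ Kt a t := by
  obtain ⟨⟨h1, k1, l1⟩, h2, k2, l2⟩ := hz
  obtain ⟨⟨h3, k3, l3⟩, h4, k4, l4⟩ := hw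
  refine ⟨⟨(2 : ℝ) • (h1 + h3), It_smul (by norm_num) (It_add k1 k3), (add_star_sq_le z w).trans ?_⟩,
    ⟨(2 : ℝ) • (h2 + h4), It_smul (by norm_num) (It_add k2 k4), ?_⟩⟩
  · gcongr
  · have := add_star_sq_le (star z) (star w)
    simp only [star_add, star_star] at this ⊢
    exact this.trans (by gcongr)

lemma Kt_mul_left {a z : B} {t : ℝ} (hz : z ∈ Kt a t) (p : B) : p * z ∈ Kt a t := by
  obtain ⟨⟨h1, k1, l1⟩, h2, k2, l2⟩ := hz
  refine ⟨⟨(‖p‖ ^ 2) • h1, It_smul (by positivity) k1, ?_⟩, ⟨p * h2 * star p, ?_, ?_⟩⟩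
  · have h := star_left_conjugate_le_conjugate
      (CStarAlgebra.star_mul_le_algebraMap_norm_sq (a := p)) z
    rw [Algebra.algebraMap_eq_smul_one] at h
    calc star (p * z) * (p * z) = star z * (star p * p) * z := by simp [mul_assoc]
      _ ≤ (‖p‖ ^ 2) • (star z * z) := by simpa using h
      _ ≤ _ := by gcongr
  · simpa using It_conj k2 (star p)
  · have := star_right_conjugate_le_conjugate l2 p
    simpa [mul_assoc] using this

lemma Kt_mul_right {a z : B} {t : ℝ} (hz : z ∈ Kt a t) (p : B) : z * p ∈ Kt a t := by
  have := Kt_star (Kt_mul_left (Kt_star hz) (star p))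
  simpa using this

lemma Kt_of_It {a d : B} {t : ℝ} (hd : d ∈ It a t) : d ∈ Kt a t := by
  have h0 := It_nonneg hd
  have hs : star d = d := (IsSelfAdjoint.of_nonneg h0).star_eq
  have h2 : d * d ∈ It a t := by
    have := It_conj hd (CFC.sqrt d)
    have hq : star (CFC.sqrt d) = CFC.sqrt d :=
      (IsSelfAdjoint.of_nonneg (CFC.sqrt_nonneg d)).star_eq
    have e : CFC.sqrt d * CFC.sqrt d = d := CFC.sqrt_mul_sqrt_self d
    have : star (CFC.sqrt d) * d * CFC.sqrt d = d * d := by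
      rw [hq]
      nth_rw 2 [← e]
      rw [← mul_assoc, mul_assoc, e]
    rwa [← this]
  exact ⟨⟨_, h2, by rw [hs]⟩, ⟨_, h2, by rw [hs]⟩⟩

lemma Jt_ideal (a : B) (t : ℝ) : IsClosedIdeal (closure (Kt a t)) := by
  refine ⟨isClosed_closure, subset_closure (Kt_zero a t), ?_, ?_, ?_⟩
  · intro x hx y hy
    exact map_mem_closure₂ continuous_add hx hy fun _ h _ h' => Kt_add h h'
  · intro c x hx
    refine map_mem_closure (continuous_const_smul c) hx fun z hz => ?_
    have := Kt_mul_left hz (c • 1)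
    simpa using this
  · intro b x hx
    exact ⟨map_mem_closure (f := fun y => b * y) (continuous_const_mul b) hx
        fun z hz => Kt_mul_left hz b,
      map_mem_closure (f := fun y => y * b) (continuous_mul_const b) hx fun z hz => Kt_mul_right hz b⟩

lemma Jt_star {a x : B} {t : ℝ} (hx : x ∈ closure (Kt a t)) : star x ∈ closure (Kt a t) :=
  map_mem_closure continuous_star hx fun _ h => Kt_star h

/-- One layer: approximating an element of the closed ideal from above. -/
lemma Jt_approx {a x : B} {t : ℝ} (hxJ : x ∈ closure (Kt a t)) (hx : IsSelfAdjoint x)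
    (hx1 : x ≤ 1) {κ : ℝ} (hκ : 0 < κ) :
    ∃ d ∈ It a t, d ≤ 1 ∧ x ≤ d + (2 * κ) • (1 : B) := by
  have hc : Continuous fun z : B => ‖x * x - star z * z‖ := by fun_prop
  have hU : IsOpen {z : B | ‖x * x - star z * z‖ < κ ^ 3} := isOpen_lt hc continuous_const
  obtain ⟨z, hzU, hzK⟩ := mem_closure_iff.1 hxJ _ hU (by simpa [hx.star_eq] using pow_pos hκ 3)
  obtain ⟨⟨h, hh, hzh⟩, -⟩ := hzK
  have hsa : IsSelfAdjoint (x * x - star z * z) := by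
    have : IsSelfAdjoint (x * x) := by simpa [hx.star_eq] using IsSelfAdjoint.star_mul_self x
    exact this.sub (IsSelfAdjoint.star_mul_self z)
  have h1 := hsa.le_algebraMap_norm_self
  rw [Algebra.algebraMap_eq_smul_one] at h1
  have h2 : x * x ≤ h + (κ ^ 3) • (1 : B) := by
    calc x * x = star z * z + (x * x - star z * z) := by abel
      _ ≤ h + ‖x * x - star z * z‖ • (1 : B) := add_le_add hzh h1
      _ ≤ h + (κ ^ 3) • (1 : B) := by
        gcongr
        exact le_of_lt hzU
  obtain ⟨g, hg, hg1, hg2⟩ := key_approx hx hx1 (It_nonneg hh) hκ h2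
  refine ⟨g * h * g, ?_, hg1, hg2⟩
  simpa [hg.star_eq] using It_conj hh g

lemma mono_of_pos (f : B →ₗ[ℝ] ℝ) (hf : ∀ x, 0 ≤ x → 0 ≤ f x) {x y : B} (h : x ≤ y) :
    f x ≤ f y := by
  have := hf (y - x) (sub_nonneg.2 h)
  rw [map_sub] at this
  linarith

lemma step {a : B} {t : ℝ} (f : B →ₗ[ℝ] ℝ) (hf : ∀ x, 0 ≤ x → 0 ≤ f x)
    (s : Bˣ) (hs : 1 - star (s : B) * s ∈ closure (Kt a t)) {w : B} (hwJ : w ∈ closure (Kt a t))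
    (hw : IsSelfAdjoint w) (hw1 : w ≤ 1) {ε : ℝ} (hε : 0 < ε) :
    ∃ d ∈ It a t, (∃ θ : ℝ, 0 < θ ∧ d ≤ (1 - θ) • (1 : B)) ∧
      f (star (s : B) * s) - f 1 + f w - ε ≤ f (star (s : B) * d * s) := by
  set F := f (star (s : B) * s) with hF
  have hF0 : 0 ≤ F := hf _ (star_mul_self_nonneg _)
  obtain ⟨κ, hκ, hκ1, hκε⟩ : ∃ κ : ℝ, 0 < κ ∧ κ ≤ 1 ∧ 3 * κ * F ≤ ε := by
    refine ⟨min 1 (ε / (3 * (F + 1))), by positivity, min_le_left _ _, ?_⟩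
    have : min 1 (ε / (3 * (F + 1))) ≤ ε / (3 * (F + 1)) := min_le_right _ _
    rw [le_div_iff₀ (by positivity)] at this
    have h0 : 0 < min 1 (ε / (3 * (F + 1))) := by positivity
    nlinarith
  set si : B := ((s⁻¹ : Bˣ) : B) with hsi
  have e1 : (s : B) * si = 1 := s.mul_inv
  have e2 : si * (s : B) = 1 := s.inv_mul
  have e3 : star (s : B) * star si = 1 := by rw [← star_mul, e2, star_one]
  have e4 : star si * star (s : B) = 1 := by rw [← star_mul, e1, star_one]
  set x : B := 1 - star si * (1 - w) * si with hxdef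
  have hxJ : x ∈ closure (Kt a t) := by
    have ex : x = star si * (w - (1 - star (s : B) * s)) * si := by
      have : star si * (star (s : B) * s) * si = 1 := by
        rw [← mul_assoc, e4, one_mul, e1]
      rw [hxdef]
      nth_rw 1 [← this]
      noncomm_ring
    obtain ⟨_, _, hadd, hsm, hmul⟩ := Jt_ideal a t
    rw [ex]
    refine (hmul si _ ((hmul (star si) _ ?_).1)).2
    have := hadd _ hwJ _ (hsm (-1) _ hs)
    rw [neg_one_smul, ← sub_eq_add_neg] at this
    exact this
  have hxsa : IsSelfAdjoint x := by
    have : IsSelfAdjoint (1 - w) := (IsSelfAdjoint.one B).sub hw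
    exact (IsSelfAdjoint.one B).sub (this.conjugate' si)
  have hx1 : x ≤ 1 := sub_le_self _ (star_left_conjugate_nonneg (sub_nonneg.2 hw1) si)
  obtain ⟨d, hd, hd1, hxd⟩ := Jt_approx hxJ hxsa hx1 hκ
  have hsx : star (s : B) * x * s = star (s : B) * s - 1 + w := by
    have : star (s : B) * (star si * (1 - w) * si) * s = 1 - w := by
      calc _ = (star (s : B) * star si) * (1 - w) * (si * s) := by simp only [mul_assoc]
        _ = 1 - w := by rw [e3, e2, one_mul, mul_one]
    rw [hxdef, mul_sub, sub_mul, this, mul_one]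
    abel
  have k1 := mono_of_pos f hf (star_left_conjugate_le_conjugate hxd (s : B))
  have k2 := mono_of_pos f hf (star_left_conjugate_le_conjugate hd1 (s : B))
  rw [hsx] at k1
  simp only [mul_add, add_mul, map_add, map_sub, mul_smul_comm, smul_mul_assoc, map_smul,
    mul_one, smul_eq_mul] at k1 k2
  refine ⟨(1 - κ) • d, It_smul (by linarith) hd, ⟨κ, hκ, ?_⟩, ?_⟩
  · exact smul_le_smul_of_nonneg_left hd1 (by linarith)
  · simp only [mul_smul_comm, smul_mul_assoc, map_smul, smul_eq_mul]
    nlinarith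

lemma layers {a : B} {τ ε : ℝ} (hτ : 0 ≤ τ) (hε : 0 < ε)
    (f : B →ₗ[ℝ] ℝ) (hf : ∀ x, 0 ≤ x → 0 ≤ f x) (hf1 : f 1 = 1) (ν : ℕ → ℝ)
    (hν : ∀ k : ℕ, ∃ w ∈ closure (Kt a (k * τ)), IsSelfAdjoint w ∧ w ≤ 1 ∧ ν k - ε / 2 ≤ f w)
    (m : ℕ) : ∀ k : ℕ, ∃ (D T : B) (s : Bˣ), (D, T) ∈ Gm a ∧ D + star (s : B) * s = 1 ∧
      D ∈ closure (Kt a (k * τ)) ∧ ν k - ε ≤ f D ∧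
      k * τ * f D + τ * ∑ j ∈ Finset.range m, (ν (k + 1 + j) - ε) ≤ f T := by
  have main : ∀ k : ℕ, ∀ (D T : B) (s : Bˣ), (D, T) ∈ Gm a → D + star (s : B) * s = 1 →
      D ∈ closure (Kt a (k * τ)) → ∃ (D' T' : B) (s' : Bˣ), (D', T') ∈ Gm a ∧
        D' + star (s' : B) * s' = 1 ∧ D' ∈ closure (Kt a (k * τ)) ∧ ν k - ε ≤ f D' ∧
        f T + k * τ * (f D' - f D) ≤ f T' := by
    intro k D T s hDT hDs hDJ
    obtain ⟨w, hwJ, hw, hw1, hfw⟩ := hν k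
    have hD : D = 1 - star (s : B) * s := by rw [← hDs]; abel
    obtain ⟨d, hd, ⟨θ, hθ, hdθ⟩, hfd⟩ := step f hf s (hD ▸ hDJ) hwJ hw hw1 (half_pos hε)
    obtain ⟨S, hdS, hS⟩ := id hd
    have hpos : θ • (1 : B) ≤ 1 - d := by
      rw [le_sub_iff_add_le, ← le_sub_iff_add_le']
      convert hdθ using 1
      module
    have h1d : 0 ≤ 1 - d := (smul_one_nonneg' hθ.le).trans hpos
    have hunit : IsUnit (1 - d) := by
      refine CStarAlgebra.isUnit_of_le (θ • (1 : B)) hpos ⟨smul_one_nonneg' hθ.le, ?_⟩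
      rw [← Algebra.algebraMap_eq_smul_one]
      exact (IsUnit.mk0 θ hθ.ne').map (algebraMap ℝ B)
    set q := CFC.sqrt (1 - d) with hq
    have hqq : q * q = 1 - d := CFC.sqrt_mul_sqrt_self (1 - d)
    have hqs : star q = q := (IsSelfAdjoint.of_nonneg (CFC.sqrt_nonneg _)).star_eq
    have hqu : IsUnit q := by
      rw [← hqq, ← sq] at hunit
      exact (isUnit_pow_iff two_ne_zero).1 hunit
    obtain ⟨Q, hQ⟩ := hqu
    refine ⟨D + star (s : B) * d * s, T + star (s : B) * S * s, Q * s, ?_, ?_, ?_, ?_, ?_⟩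
    · exact (Gm a).add_mem hDT (Gm_conj hdS (s : B))
    · have : star ((Q * s : Bˣ) : B) * ((Q * s : Bˣ) : B) = star (s : B) * (1 - d) * s := by
        rw [Units.val_mul, hQ, star_mul, hqs, ← hqq]
        simp only [mul_assoc]
      rw [this, hD]
      noncomm_ring
    · obtain ⟨_, _, hadd, hsm, hmul⟩ := Jt_ideal a (k * τ)
      refine hadd _ hDJ _ (hmul _ _ (hmul _ _ ?_).1).2
      exact subset_closure (Kt_of_It hd)
    · rw [map_add]
      have : f D = f 1 - f (star (s : B) * s) := by rw [hD, map_sub]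
      linarith
    · have := mono_of_pos f hf (star_left_conjugate_le_conjugate hS (s : B))
      simp only [mul_smul_comm, smul_mul_assoc, map_smul, smul_eq_mul] at this
      rw [map_add, map_add]
      linarith
  induction m with
  | zero =>
    intro k
    obtain ⟨D, T, s, h1, h2, h3, h4, h5⟩ := main k 0 0 1 (Gm a).zero_mem (by simp)
      (subset_closure (Kt_zero _ _))
    refine ⟨D, T, s, h1, h2, h3, h4, ?_⟩
    simpa using h5
  | succ m ih =>
    intro k
    obtain ⟨D, T, s, h1, h2, h3, h4, h5⟩ := ih (k + 1)
    have hle : (k : ℝ) * τ ≤ ((k + 1 : ℕ) : ℝ) * τ := by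
      push_cast
      nlinarith
    obtain ⟨D', T', s', h1', h2', h3', h4', h5'⟩ := main k D T s h1 h2
      (closure_mono (Kt_mono hle) h3)
    refine ⟨D', T', s', h1', h2', h3', h4', le_trans ?_ h5'⟩
    rw [Finset.sum_range_succ']
    have hsum : ∑ j ∈ Finset.range m, (ν (k + 1 + (j + 1)) - ε)
        = ∑ j ∈ Finset.range m, (ν (k + 1 + 1 + j) - ε) :=
      Finset.sum_congr rfl fun j _ => by rw [show k + 1 + (j + 1) = k + 1 + 1 + j by ring]
    rw [hsum, add_zero]
    push_cast at h5
    have := mul_le_mul_of_nonneg_left h4 hτ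
    nlinarith

lemma upper {a : B} (ha : 0 ≤ a) {τ : ℝ} (hτ : 0 < τ) (n : ℕ) (hn : ‖a‖ ≤ n * τ)
    (f : B →ₗ[ℝ] ℝ) (ν : ℕ → ℝ)
    (hν : ∀ (k : ℕ) (x : B), x ∈ closure (Kt a (k * τ)) → ‖x‖ ≤ 1 → f x ≤ ν k) :
    f a ≤ τ * ∑ k ∈ Finset.range n, ν k := by
  have hasa : IsSelfAdjoint a := IsSelfAdjoint.of_nonneg ha
  let M : ℕ → B := fun k => cfc (fun s : ℝ => min s (k * τ)) a
  have hsp : ∀ s ∈ spectrum ℝ a, 0 ≤ s := fun s hs => spectrum_nonneg_of_nonneg ha hs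
  have hsp1 : ∀ s ∈ spectrum ℝ a, s ≤ n * τ := fun s hs =>
    (le_algebraMap_iff_spectrum_le (r := ‖a‖) (a := a) hasa).1
      hasa.le_algebraMap_norm_self s hs |>.trans hn
  have cM : ∀ k : ℕ, ContinuousOn (fun s : ℝ => min s (k * τ)) (spectrum ℝ a) := fun k => by
    fun_prop
  have hM0 : M 0 = 0 := by
    have : M 0 = cfc (fun _ : ℝ => (0 : ℝ)) a := cfc_congr fun s hs => by simp [hsp s hs]
    rw [this, cfc_const_zero]
  have hMn : M n = a := by
    have : M n = cfc (fun s : ℝ => s) a := cfc_congr fun s hs => by simp [hsp1 s hs]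
    rw [this, cfc_id' ℝ a]
  have hsum : a = ∑ k ∈ Finset.range n, (M (k + 1) - M k) := by
    rw [Finset.sum_range_sub, hM0, hMn, sub_zero]
  have hstep : ∀ k : ℕ, f (M (k + 1) - M k) ≤ τ * ν k := by
    intro k
    let φ : ℝ → ℝ := fun s => τ⁻¹ * (min s ((k + 1 : ℕ) * τ) - min s (k * τ))
    have cφ : ContinuousOn φ (spectrum ℝ a) := by fun_prop
    have hk : (k : ℝ) * τ ≤ ((k + 1 : ℕ) : ℝ) * τ := by
      push_cast
      nlinarith
    have hkk : ((k + 1 : ℕ) : ℝ) * τ = k * τ + τ := by push_cast; ring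
    set e : B := cfc φ a with he
    have hφ0 : ∀ s, 0 ≤ φ s := fun s =>
      mul_nonneg (by positivity) (sub_nonneg.2 (min_le_min_left s hk))
    have hφ1 : ∀ s, φ s ≤ 1 := fun s => by
      have : min s ((k + 1 : ℕ) * τ) - min s (k * τ) ≤ τ := by
        rw [hkk]
        rcases le_total s (k * τ) with h | h
        · rw [min_eq_left h]
          linarith [min_le_left s (k * τ + τ)]
        · rw [min_eq_right h]
          linarith [min_le_right s (k * τ + τ)]
      calc φ s ≤ τ⁻¹ * τ := by
            change τ⁻¹ * _ ≤ _
            gcongr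
        _ = 1 := inv_mul_cancel₀ hτ.ne'
    have hMe : M (k + 1) - M k = τ • e := by
      rw [he, ← cfc_smul τ φ a cφ, ← cfc_sub _ _ a (cM (k + 1)) (cM k)]
      refine cfc_congr fun s _ => ?_
      simp only [φ, smul_eq_mul]
      rw [← mul_assoc, mul_inv_cancel₀ hτ.ne', one_mul]
    have hesa : IsSelfAdjoint e := cfc_predicate _ a
    have hee : star e * e ∈ It a (k * τ) := by
      refine ⟨_, Gm_gen a e, ?_⟩
      have e1 : (k * τ) • (star e * e) = cfc (fun s => (k * τ) • (φ s * φ s)) a := by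
        rw [hesa.star_eq, cfc_smul (k * τ) (fun s => φ s * φ s) a (cφ.mul cφ),
          cfc_mul φ φ a cφ cφ]
      have e2 : star e * a * e = cfc (fun s => φ s * s * φ s) a := by
        rw [hesa.star_eq, cfc_mul (fun s => φ s * s) φ a (cφ.mul continuousOn_id) cφ,
          cfc_mul φ (fun s => s) a cφ continuousOn_id, cfc_id' ℝ a]
      rw [e1, e2]
      refine cfc_mono (fun s _ => ?_) (continuousOn_const.mul (cφ.mul cφ))
        ((cφ.mul continuousOn_id).mul cφ)
      rw [smul_eq_mul]
      rcases le_total s (k * τ) with h | h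
      · have : φ s = 0 := by
          simp only [φ]
          rw [min_eq_left h, min_eq_left (h.trans hk)]
          simp
        simp [this]
      · nlinarith [mul_self_nonneg (φ s)]
    have heK : e ∈ Kt a (k * τ) :=
      ⟨⟨_, hee, le_rfl⟩, ⟨_, hee, by rw [hesa.star_eq]⟩⟩
    have hen : ‖e‖ ≤ 1 := norm_cfc_le zero_le_one fun s _ => by
      rw [Real.norm_eq_abs, abs_of_nonneg (hφ0 s)]
      exact hφ1 s
    rw [hMe, map_smul, smul_eq_mul]
    exact mul_le_mul_of_nonneg_left (hν k e (subset_closure heK) hen) hτ.le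
  calc f a = ∑ k ∈ Finset.range n, f (M (k + 1) - M k) := by
        conv_lhs => rw [hsum]
        rw [map_sum]
    _ ≤ ∑ k ∈ Finset.range n, τ * ν k := Finset.sum_le_sum fun k _ => hstep k
    _ = _ := by rw [Finset.mul_sum]

/-- The real part of a functional as a real-linear map. -/
def reLin (ω : B →L[ℂ] ℂ) : B →ₗ[ℝ] ℝ :=
  Complex.reLm ∘ₗ (ω.toLinearMap.restrictScalars ℝ)

lemma reLin_apply (ω : B →L[ℂ] ℂ) (x : B) : reLin ω x = (ω x).re := rfl

lemma state_nonneg {ω : B →L[ℂ] ℂ} (hω : IsState ω) {x : B} (hx : 0 ≤ x) : 0 ≤ ω x := by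
  obtain ⟨b, rfl⟩ := CStarAlgebra.nonneg_iff_eq_star_mul_self.1 hx
  exact hω.1 b

lemma reLin_nonneg {ω : B →L[ℂ] ℂ} (hω : IsState ω) (x : B) (hx : 0 ≤ x) : 0 ≤ reLin ω x :=
  (Complex.le_def.1 (state_nonneg hω hx)).1

lemma state_im_sa {ω : B →L[ℂ] ℂ} (hω : IsState ω) {x : B} (hx : IsSelfAdjoint x) :
    (ω x).im = 0 := by
  have h1 := hx.neg_algebraMap_norm_le_self
  have h2 : 0 ≤ x + algebraMap ℝ B ‖x‖ := by
    rw [← sub_neg_eq_add]; exact sub_nonneg.2 h1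
  have h3 := (Complex.le_def.1 (state_nonneg hω h2)).2
  have h4 : algebraMap ℝ B ‖x‖ = (‖x‖ : ℂ) • (1 : B) := by
    rw [Algebra.algebraMap_eq_smul_one]
    exact (Complex.coe_smul ‖x‖ (1 : B)).symm
  rw [h4, map_add, map_smul, hω.2] at h3
  simpa using h3.symm

lemma state_re_star {ω : B →L[ℂ] ℂ} (hω : IsState ω) (x : B) :
    (ω (star x)).re = (ω x).re := by
  have h : IsSelfAdjoint (Complex.I • (x - star x)) := by
    rw [isSelfAdjoint_iff, star_smul, star_sub, star_star]
    simp [← smul_neg]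
  have := state_im_sa hω h
  rw [map_smul, map_sub] at this
  simp at this
  linarith

lemma le_normRestrict (ω : B →L[ℂ] ℂ) {J : Set B} {x : B} (hx : x ∈ J) (hx1 : ‖x‖ ≤ 1) :
    ‖ω x‖ ≤ normRestrict ω J := by
  refine le_csSup ⟨‖ω‖, ?_⟩ ⟨x, hx, hx1, rfl⟩
  rintro _ ⟨y, _, hy, rfl⟩
  exact ω.unit_le_opNorm y hy

lemma normRestrict_le (ω : B →L[ℂ] ℂ) {J : Set B} (h0 : (0 : B) ∈ J) {C : ℝ}
    (h : ∀ x ∈ J, ‖x‖ ≤ 1 → ‖ω x‖ ≤ C) : normRestrict ω J ≤ C := by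
  refine csSup_le ⟨_, 0, h0, by simp, rfl⟩ ?_
  rintro _ ⟨y, hy, hy1, rfl⟩
  exact h y hy hy1

lemma exists_w {ω : B →L[ℂ] ℂ} (hω : IsState ω) (a : B) (t : ℝ) {δ : ℝ} (hδ : 0 < δ) :
    ∃ w ∈ closure (Kt a t), IsSelfAdjoint w ∧ w ≤ 1 ∧
      normRestrict ω (closure (Kt a t)) - δ ≤ reLin ω w := by
  obtain ⟨_, h0, hadd, hsm, hmul⟩ := Jt_ideal a t
  have hne : {r : ℝ | ∃ x ∈ closure (Kt a t), ‖x‖ ≤ 1 ∧ r = ‖ω x‖}.Nonempty :=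
    ⟨_, 0, h0, by simp, rfl⟩
  obtain ⟨_, ⟨u, hu, hu1, rfl⟩, hlt⟩ := exists_lt_of_lt_csSup hne (sub_lt_self _ hδ)
  obtain ⟨c, hc, hcu⟩ := RCLike.exists_norm_eq_mul_self (ω u)
  set v : B := c • u with hv
  have hvJ : v ∈ closure (Kt a t) := hsm c u hu
  have hv1 : ‖v‖ ≤ 1 := by rw [hv, norm_smul, hc, one_mul]; exact hu1
  have hωv : ω v = (‖ω u‖ : ℂ) := by rw [hv, map_smul, smul_eq_mul]; exact hcu.symm
  set w : B := (1 / 2 : ℂ) • (v + star v) with hw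
  have hwsa : IsSelfAdjoint w := by
    rw [hw, isSelfAdjoint_iff, star_smul, star_add, star_star, add_comm]
    simp
  have hwn : ‖w‖ ≤ 1 := by
    rw [hw, norm_smul]
    have := norm_add_le v (star v)
    rw [norm_star] at this
    norm_num
    linarith
  refine ⟨w, hsm _ _ (hadd _ hvJ _ (Jt_star hvJ)), hwsa, ?_, ?_⟩
  · refine hwsa.le_algebraMap_norm_self.trans ?_
    rw [Algebra.algebraMap_eq_smul_one]
    calc ‖w‖ • (1 : B) ≤ (1 : ℝ) • (1 : B) := smul_le_smul_of_nonneg_right hwn zero_le_one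
      _ = 1 := one_smul _ _
  · have h1 : ω w = (1 / 2 : ℂ) * (ω v + ω (star v)) := by rw [hw, map_smul, map_add, smul_eq_mul]
    have h2 : (ω w).re = ‖ω u‖ := by
      have h3 := state_re_star hω v
      rw [hωv, Complex.ofReal_re] at h3
      have : (1 / 2 : ℂ) = ((1 / 2 : ℝ) : ℂ) := by norm_num
      rw [h1, this, Complex.re_ofReal_mul, Complex.add_re, h3, hωv, Complex.ofReal_re]
      ring
    rw [reLin_apply, h2]
    exact hlt.le

lemma main_pos {ω ρ : B →L[ℂ] ℂ} (hω : IsState ω)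
    (h : ∀ J : Set B, IsClosedIdeal J → normRestrict ρ J ≤ normRestrict ω J)
    {a : B} (ha : 0 ≤ a) {ε : ℝ} (hε : 0 < ε) :
    ∃ (n : ℕ) (c : Fin n → B), (∑ i, star (c i) * c i) = 1 ∧
      reLin ρ a - ε ≤ reLin ω (∑ i, star (c i) * a * c i) := by
  set M : ℝ := ‖a‖ + 1 with hM
  have hMpos : 0 < M := by positivity
  obtain ⟨m, hm⟩ := exists_nat_ge (2 * M * ‖ω‖ / ε)
  have hm1 : (0 : ℝ) < m + 1 := by positivity
  set τ : ℝ := M / (m + 1) with hτ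
  have hτpos : 0 < τ := by positivity
  have hτm : (m + 1) * τ = M := by rw [hτ]; field_simp
  have hτω : τ * ‖ω‖ ≤ ε / 2 := by
    rw [div_le_iff₀ hε] at hm
    rw [hτ, div_mul_eq_mul_div, div_le_iff₀ hm1]
    nlinarith
  set ε' : ℝ := ε / (2 * M) with hε'
  have hε'pos : 0 < ε' := by positivity
  have hMε : M * ε' = ε / 2 := by rw [hε']; field_simp
  set ν : ℕ → ℝ := fun k => normRestrict ω (closure (Kt a (k * τ))) with hν
  have hν0 : ν 0 ≤ ‖ω‖ :=
    normRestrict_le ω (subset_closure (Kt_zero _ _)) fun x _ hx => ω.unit_le_opNorm x hx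
  obtain ⟨D, T, s, h1, h2, -, -, h5⟩ := layers (a := a) hτpos.le hε'pos (reLin ω)
    (reLin_nonneg hω) (by rw [reLin_apply, hω.2]; simp) ν
    (fun k => exists_w hω a (k * τ) (half_pos hε'pos)) m 0
  have hup := upper ha hτpos (m + 1) (by push_cast; rw [hτm, hM]; linarith) (reLin ρ) ν
    (fun k x hx hx1 => (Complex.re_le_norm _).trans
      ((le_normRestrict ρ hx hx1).trans (h _ (Jt_ideal a _))))
  rw [Finset.sum_range_succ'] at hup
  obtain ⟨n, c, hc1, hc2⟩ := Gm_fin ((Gm a).add_mem h1 (Gm_gen a (s : B)))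
  refine ⟨n, c, ?_, ?_⟩
  · rw [← hc1]; exact h2
  · rw [← hc2]
    change _ ≤ reLin ω (T + star (s : B) * a * s)
    rw [map_add]
    have h6 := reLin_nonneg hω _ (star_left_conjugate_nonneg ha (s : B))
    have hsum : ∑ j ∈ Finset.range m, (ν (0 + 1 + j) - ε')
        = ∑ j ∈ Finset.range m, ν (j + 1) - m * ε' := by
      rw [Finset.sum_sub_distrib, Finset.sum_const, Finset.card_range, nsmul_eq_mul]
      congr 1
      exact Finset.sum_congr rfl fun j _ => by rw [show 0 + 1 + j = j + 1 by ring]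
    rw [hsum] at h5
    simp only [Nat.cast_zero, zero_mul, zero_add] at h5
    have h7 := mul_le_mul_of_nonneg_left hν0 hτpos.le
    have h8 : τ * (m * ε') ≤ ε / 2 := by
      rw [← hMε, ← hτm]
      nlinarith [mul_pos hτpos hε'pos]
    rw [mul_add] at hup
    rw [mul_sub] at h5
    linarith

lemma main_sa {ω ρ : B →L[ℂ] ℂ} (hω : IsState ω) (hρ : IsState ρ)
    (h : ∀ J : Set B, IsClosedIdeal J → normRestrict ρ J ≤ normRestrict ω J)
    {a : B} (ha : IsSelfAdjoint a) {ε : ℝ} (hε : 0 < ε) :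
    ∃ (n : ℕ) (c : Fin n → B), (∑ i, star (c i) * c i) = 1 ∧
      reLin ρ a - ε ≤ reLin ω (∑ i, star (c i) * a * c i) := by
  have h2 : 0 ≤ a + ‖a‖ • (1 : B) := by
    have := ha.neg_algebraMap_norm_le_self
    rw [Algebra.algebraMap_eq_smul_one] at this
    rw [← sub_neg_eq_add]; exact sub_nonneg.2 this
  obtain ⟨n, c, hc, hle⟩ := main_pos hω h h2 hε
  refine ⟨n, c, hc, ?_⟩
  have e : ∑ i, star (c i) * (a + ‖a‖ • (1 : B)) * c i
      = (∑ i, star (c i) * a * c i) + ‖a‖ • (1 : B) := by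
    have e' : ‖a‖ • (1 : B) = ∑ i, ‖a‖ • (star (c i) * c i) := by rw [← Finset.smul_sum, hc]
    nth_rw 2 [e']
    rw [← Finset.sum_add_distrib]
    refine Finset.sum_congr rfl fun i _ => ?_
    rw [mul_add, add_mul, mul_smul_comm, smul_mul_assoc, mul_one]
  have hω1 : reLin ω 1 = 1 := by rw [reLin_apply, hω.2]; simp
  have hρ1 : reLin ρ 1 = 1 := by rw [reLin_apply, hρ.2]; simp
  rw [e, map_add, map_add, map_smul, map_smul, hω1, hρ1] at hle
  linarith

/-- The elementary map attached to a family. -/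
def elemMap {n : ℕ} (c : Fin n → B) : B →L[ℂ] B :=
  ∑ i, (ContinuousLinearMap.mul ℂ B (star (c i))).comp ((ContinuousLinearMap.mul ℂ B).flip (c i))

lemma elemMap_apply {n : ℕ} (c : Fin n → B) (x : B) :
    elemMap c x = ∑ i, star (c i) * x * c i := by
  simp [elemMap, mul_assoc]

lemma elemMap_mem {n : ℕ} (c : Fin n → B) (hc : (∑ i, star (c i) * c i) = 1) (ω : B →L[ℂ] ℂ) :
    ω.comp (elemMap c) ∈ mixSet ω :=
  ⟨elemMap c, ⟨n, c, hc, elemMap_apply c⟩, rfl⟩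

lemma elem_norm_le {n : ℕ} (c : Fin n → B) (hc : (∑ i, star (c i) * c i) = 1) {x : B}
    (hx : ‖x‖ ≤ 1) : ‖∑ i, star (c i) * x * c i‖ ≤ 1 := by
  set y := ∑ i, star (c i) * x * c i with hy
  have hys : star y = ∑ i, star (c i) * star x * c i := by
    rw [hy, star_sum]
    exact Finset.sum_congr rfl fun i _ => by simp [mul_assoc]
  have h0 : 0 ≤ ∑ i, star (x * c i - c i * y) * (x * c i - c i * y) :=
    Finset.sum_nonneg fun i _ => star_mul_self_nonneg _
  have h1 : ∑ i, star (x * c i - c i * y) * (x * c i - c i * y)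
      = (∑ i, star (c i) * (star x * x) * c i) - star y * y := by
    have e : ∀ i, star (x * c i - c i * y) * (x * c i - c i * y)
        = star (c i) * (star x * x) * c i - (star (c i) * star x * c i) * y
          - star y * (star (c i) * x * c i) + star y * (star (c i) * c i) * y := by
      intro i
      simp only [star_sub, star_mul]
      noncomm_ring
    simp only [e, Finset.sum_add_distrib, Finset.sum_sub_distrib]
    rw [← Finset.sum_mul, ← Finset.sum_mul, ← Finset.mul_sum, ← Finset.mul_sum, hc, ← hys, ← hy]
    noncomm_ring
  rw [h1, sub_nonneg] at h0
  have h2 : star x * x ≤ 1 := by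
    refine (CStarAlgebra.norm_le_one_iff_of_nonneg _ (star_mul_self_nonneg x)).1 ?_
    rw [CStarRing.norm_star_mul_self]
    nlinarith [norm_nonneg x]
  have h3 : ∑ i, star (c i) * (star x * x) * c i ≤ 1 := by
    rw [← hc]
    refine Finset.sum_le_sum fun i _ => ?_
    have := star_left_conjugate_le_conjugate h2 (c i)
    simpa using this
  have h4 := (CStarAlgebra.norm_le_one_iff_of_nonneg _ (star_mul_self_nonneg y)).2 (h0.trans h3)
  rw [CStarRing.norm_star_mul_self] at h4
  nlinarith [norm_nonneg y]

lemma forward {ω ρ : B →L[ℂ] ℂ} (h : InWeakStarClosure (mixSet ω) ρ)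
    {J : Set B} (hJ : IsClosedIdeal J) : normRestrict ρ J ≤ normRestrict ω J := by
  obtain ⟨_, h0, hadd, hsm, hmul⟩ := hJ
  refine normRestrict_le ρ h0 fun x hx hx1 => le_of_forall_pos_le_add fun ε hε => ?_
  obtain ⟨σ, ⟨φ, ⟨n, c, hc, hφ⟩, rfl⟩, hσ⟩ := h ε hε 1 (fun _ => x)
  have h1 := hσ 0
  have hmem : φ x ∈ J := by
    rw [hφ]
    refine Finset.sum_induction _ (· ∈ J) (fun x y hx hy => hadd x hx y hy) h0 fun i _ => ?_
    exact (hmul _ _ (hmul _ _ hx).1).2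
  have h2 : ‖ω (φ x)‖ ≤ normRestrict ω J := le_normRestrict ω hmem (by
    rw [hφ]; exact elem_norm_le c hc hx1)
  rw [ContinuousLinearMap.comp_apply] at h1
  have h3 := norm_add_le (ρ x - ω (φ x)) (ω (φ x))
  rw [sub_add_cancel] at h3
  linarith

lemma mixSet_convex (ω : B →L[ℂ] ℂ) : Convex ℝ (mixSet ω) := by
  rintro _ ⟨φ, ⟨n, c, hc, hφ⟩, rfl⟩ _ ⟨ψ, ⟨m, e, he, hψ⟩, rfl⟩ p q hp hq hpq
  refine ⟨p • φ + q • ψ, ⟨n + m, Fin.append (fun i => √p • c i) (fun i => √q • e i), ?_, ?_⟩, ?_⟩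
  · simp only [Fin.sum_univ_add, Fin.append_left, Fin.append_right, star_smul, smul_mul_smul_comm,
      star_trivial, Real.mul_self_sqrt hp, Real.mul_self_sqrt hq, ← Finset.smul_sum, hc, he,
      ← add_smul, hpq, one_smul]
  · intro x
    simp only [Fin.sum_univ_add, Fin.append_left, Fin.append_right, star_smul, smul_mul_assoc,
      mul_smul_comm, smul_smul,
      star_trivial, Real.mul_self_sqrt hp, Real.mul_self_sqrt hq, ← Finset.smul_sum,
      add_apply, smul_apply, hφ, hψ]
  · ext x
    simp [map_add]

lemma backward {ω ρ : B →L[ℂ] ℂ} (hω : IsState ω) (hρ : IsState ρ)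
    (h : ∀ J : Set B, IsClosedIdeal J → normRestrict ρ J ≤ normRestrict ω J) :
    InWeakStarClosure (mixSet ω) ρ := by
  intro ε hε n x
  let Φ : (B →L[ℂ] ℂ) →ₗ[ℝ] (Fin n → ℂ) :=
    { toFun := fun σ i => σ (x i)
      map_add' := fun _ _ => rfl
      map_smul' := fun _ _ => rfl }
  have hconv : Convex ℝ (closure (Φ '' mixSet ω)) := ((mixSet_convex ω).linear_image Φ).closure
  have key : Φ ρ ∈ closure (Φ '' mixSet ω) := by
    by_contra hnot
    obtain ⟨f, u, hfu, hu⟩ :=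
      RCLike.geometric_hahn_banach_closed_point (𝕜 := ℂ) hconv isClosed_closure hnot
    set b : B := ∑ i, f (Pi.single i 1) • x i with hb
    have hfb : ∀ σ : B →L[ℂ] ℂ, f (Φ σ) = σ b := by
      intro σ
      have e : Φ σ = ∑ i, σ (x i) • (Pi.single i (1 : ℂ) : Fin n → ℂ) := by
        ext j
        simp [Φ, Finset.sum_apply, Pi.single_apply]
      rw [e, hb, map_sum, map_sum]
      exact Finset.sum_congr rfl fun i _ => by
        rw [map_smul, map_smul, smul_eq_mul, smul_eq_mul, mul_comm]
    set a : B := b + star b with ha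
    have hasa : IsSelfAdjoint a := IsSelfAdjoint.add_star_self b
    have hu' : u < (ρ b).re := by rw [← hfb]; exact hu
    obtain ⟨m, c, hc, hle⟩ := main_sa hω hρ h hasa (ε := (ρ b).re - u) (by linarith)
    have hmem := elemMap_mem c hc ω
    have h1 := hfu _ (subset_closure ⟨_, hmem, rfl⟩)
    rw [hfb] at h1
    have h1' : (ω (elemMap c b)).re < u := h1
    have e1 : ∑ i, star (c i) * a * c i = elemMap c b + star (elemMap c b) := by
      rw [elemMap_apply, star_sum, ← Finset.sum_add_distrib]
      refine Finset.sum_congr rfl fun i _ => ?_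
      rw [ha]
      simp [mul_add, add_mul, mul_assoc]
    rw [e1, reLin_apply, reLin_apply, ha, map_add, map_add, Complex.add_re, Complex.add_re,
      state_re_star hω, state_re_star hρ] at hle
    linarith
  obtain ⟨_, ⟨σ, hσ, rfl⟩, hd⟩ := Metric.mem_closure_iff.1 key ε hε
  refine ⟨σ, hσ, fun i => ?_⟩
  rw [← dist_eq_norm]
  exact (dist_le_pi_dist (Φ ρ) (Φ σ) i).trans_lt hd

lemma main_aux (ω ρ : B →L[ℂ] ℂ) (hω : IsState ω) (hρ : IsState ρ) :
    InWeakStarClosure (mixSet ω) ρ ↔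
      ∀ J : Set B, IsClosedIdeal J → normRestrict ρ J ≤ normRestrict ω J :=
  ⟨fun h _ hJ => forward h hJ, fun h => backward hω hρ h⟩

end Helpers

/-- **Theorem.** For states `ω`, `ρ` on a unital C*-algebra `A`, `ρ` lies in the
weak* closure of `ω ∘ E(A)` if and only if `‖ρ|J‖ ≤ ‖ω|J‖` for every
norm-closed two-sided ideal `J` of `A`. -/
theorem state_mem_weakStarClosure_mixSet_iff_normRestrict_le
    (ω ρ : A →L[ℂ] ℂ) (hω : IsState ω) (hρ : IsState ρ) :
    InWeakStarClosure (mixSet ω) ρ ↔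
      ∀ J : Set A, IsClosedIdeal J → normRestrict ρ J ≤ normRestrict ω J := by
  letI : CStarAlgebra A := { }
  letI : PartialOrder A := CStarAlgebra.spectralOrder A
  haveI : StarOrderedRing A := CStarAlgebra.spectralOrderedRing A
  exact main_aux ω ρ hω hρ

end
end

section
/- For every hermitian bounded linear functional ω on a unital C*-algebra A, the weak* closure of ω∘E(A) equals the set of differences ρ₁ − ρ₂ where ρ₁ ranges over the weak* closure of ω₊∘E(A) and ρ₂ over the weak* closure of ω₋∘E(A); that is, cl(ω∘E(A)) = cl(ω₊∘E(A)) − cl(ω₋∘E(A)). -/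
universe u

open scoped ComplexConjugate ComplexOrder

noncomputable section

variable {A : Type u} [NormedRing A] [StarRing A] [CStarRing A]
  [NormedAlgebra ℂ A] [StarModule ℂ A] [CompleteSpace A]

set_option linter.unusedSectionVars false

lemma aux_norm_one_le : ‖(1 : A)‖ ≤ 1 := by
  have h : ‖(1 : A)‖ * ‖(1 : A)‖ = ‖(1 : A)‖ := by
    rw [← CStarRing.norm_star_mul_self]; simp
  nlinarith [norm_nonneg (1 : A)]

lemma aux_cfc_sq {B : Type u} [CStarAlgebra B] (a : B) (_ha : IsSelfAdjoint a) (f g : ℝ → ℝ)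
    (hf : Continuous f)
    (h : ∀ x : ℝ, |x| ≤ ‖a‖ → f x * f x = g x) :
    cfc f a * cfc f a = cfc g a := by
  rw [← cfc_mul f f a]
  apply cfc_congr
  intro x hx
  apply h
  have := spectrum.norm_le_norm_mul_of_mem hx
  rw [Real.norm_eq_abs] at this
  nlinarith [norm_nonneg a, aux_norm_one_le (A := B)]

lemma aux_cfc_sa {B : Type u} [CStarAlgebra B] (a : B) (f : ℝ → ℝ) : star (cfc f a) = cfc f a := by
  exact (cfc_predicate f a : IsSelfAdjoint _)

lemma aux_split {B : Type u} [CStarAlgebra B] (h : B) (hsa : IsSelfAdjoint h) (hn : ‖h‖ ≤ 1) :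
    ∃ s t r q : B, star s = s ∧ star t = t ∧ star r = r ∧ star q = q ∧
      s * s + s * s = 1 + h ∧ t * t + t * t = 1 - h ∧ s * s + t * t = 1 ∧
      r * r + s * s = s ∧ q * q + t * t = t := by
  have h1 := aux_cfc_sq h hsa (fun x => √((1 + x) / 2)) (fun x => (1 + x) / 2) (by fun_prop)
    (fun x hx => Real.mul_self_sqrt (by have := abs_le.1 (hx.trans hn); linarith))
  have h2 := aux_cfc_sq h hsa (fun x => √((1 - x) / 2)) (fun x => (1 - x) / 2) (by fun_prop)
    (fun x hx => Real.mul_self_sqrt (by have := abs_le.1 (hx.trans hn); linarith))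
  have h3 := aux_cfc_sq h hsa (fun x => √(√((1 + x) / 2) - (1 + x) / 2))
    (fun x => √((1 + x) / 2) - (1 + x) / 2) (by fun_prop)
    (fun x hx => Real.mul_self_sqrt (by
      have := abs_le.1 (hx.trans hn)
      have h0 : √((1 + x) / 2) ≤ 1 := Real.sqrt_le_one.2 (by linarith)
      have := Real.mul_self_sqrt (show 0 ≤ (1 + x) / 2 by linarith)
      nlinarith [Real.sqrt_nonneg ((1 + x) / 2)]))
  have h4 := aux_cfc_sq h hsa (fun x => √(√((1 - x) / 2) - (1 - x) / 2))
    (fun x => √((1 - x) / 2) - (1 - x) / 2) (by fun_prop)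
    (fun x hx => Real.mul_self_sqrt (by
      have := abs_le.1 (hx.trans hn)
      have h0 : √((1 - x) / 2) ≤ 1 := Real.sqrt_le_one.2 (by linarith)
      have := Real.mul_self_sqrt (show 0 ≤ (1 - x) / 2 by linarith)
      nlinarith [Real.sqrt_nonneg ((1 - x) / 2)]))
  refine ⟨cfc (fun x => √((1 + x) / 2)) h, cfc (fun x => √((1 - x) / 2)) h,
    cfc (fun x => √(√((1 + x) / 2) - (1 + x) / 2)) h,
    cfc (fun x => √(√((1 - x) / 2) - (1 - x) / 2)) h,
    aux_cfc_sa h _, aux_cfc_sa h _, aux_cfc_sa h _, aux_cfc_sa h _, ?_, ?_, ?_, ?_, ?_⟩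
  · rw [h1, ← cfc_add (R := ℝ) (a := h) _ _]
    have : (1 : B) + h = cfc (fun x : ℝ => 1 + x) h := by
      rw [cfc_const_add (R := ℝ) 1 (fun x => x) h, cfc_id' ℝ h]; simp
    rw [this]; congr 1; ext x; ring
  · rw [h2, ← cfc_add (R := ℝ) (a := h) _ _]
    have : (1 : B) - h = cfc (fun x : ℝ => 1 - x) h := by
      rw [cfc_sub (R := ℝ) (fun _ => 1) (fun x => x) h, cfc_id' ℝ h, cfc_const_one ℝ h]
    rw [this]; congr 1; ext x; ring
  · rw [h1, h2, ← cfc_add (R := ℝ) (a := h) _ _, ← cfc_const_one ℝ h]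
    congr 1; ext x; ring
  · rw [h1, h3, ← cfc_add (R := ℝ) (a := h) _ _]
    congr 1; ext x; ring
  · rw [h2, h4, ← cfc_add (R := ℝ) (a := h) _ _]
    congr 1; ext x; ring

lemma aux_norm_sq {B : Type u} [CStarAlgebra B] (x : B) :
    ∃ r : B, star r * r = ((‖x‖ ^ 2 : ℝ) : ℂ) • (1 : B) - star x * x := by
  have hsa : IsSelfAdjoint (star x * x) := IsSelfAdjoint.star_mul_self x
  have h1 := aux_cfc_sq _ hsa (fun t => √(‖x‖ ^ 2 - t)) (fun t => ‖x‖ ^ 2 - t) (by fun_prop)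
    (fun t ht => Real.mul_self_sqrt (by
      rw [CStarRing.norm_star_mul_self] at ht
      have := abs_le.1 ht; nlinarith))
  refine ⟨cfc (fun t => √(‖x‖ ^ 2 - t)) (star x * x), ?_⟩
  · rw [aux_cfc_sa, h1, cfc_sub (R := ℝ) (fun _ => ‖x‖ ^ 2) (fun x => x) _, cfc_id' ℝ _,
      cfc_const (‖x‖ ^ 2) (star x * x), Algebra.algebraMap_eq_smul_one]
    rw [Complex.coe_smul]

lemma aux_herm {σ : A →L[ℂ] ℂ} (hσ : IsPositiveFunctional σ) : IsHermitianFunctional σ := by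
  intro a
  have h0 := (Complex.nonneg_iff.1 (hσ a)).2
  have h1 := (Complex.nonneg_iff.1 (hσ 1)).2
  have h2 := (Complex.nonneg_iff.1 (hσ (a + 1))).2
  have h3 := (Complex.nonneg_iff.1 (hσ (a + Complex.I • 1))).2
  simp [add_mul, mul_add] at h0 h1 h2 h3
  apply Complex.ext
  · simp; linarith
  · simp; linarith

lemma aux_cs {σ : A →L[ℂ] ℂ} (hσ : IsPositiveFunctional σ) (a b : A) :
    ‖σ (star a * b)‖ ^ 2 ≤ (σ (star a * a)).re * (σ (star b * b)).re := by
  let c : PreInnerProductSpace.Core ℂ A :=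
    { inner := fun x y => σ (star x * y)
      conj_inner_symm := fun x y => by
        change conj (σ (star y * x)) = σ (star x * y)
        rw [← aux_herm hσ]; simp
      re_inner_nonneg := fun x => (Complex.nonneg_iff.1 (hσ x)).1
      add_left := fun x y z => by
        change σ (star (x + y) * z) = σ (star x * z) + σ (star y * z)
        simp [add_mul]
      smul_left := fun x y r => by
        change σ (star (r • x) * y) = conj r * σ (star x * y)
        simp }
  have h := @InnerProductSpace.Core.inner_mul_inner_self_le ℂ A _ _ _ c a b
  change ‖σ (star a * b)‖ * ‖σ (star b * a)‖ ≤ (σ (star a * a)).re * (σ (star b * b)).re at h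
  have e : σ (star b * a) = conj (σ (star a * b)) := by rw [← aux_herm hσ]; simp
  rw [e, RCLike.norm_conj] at h
  rw [sq]; exact h

lemma aux_sq_le {σ : A →L[ℂ] ℂ} (hσ : IsPositiveFunctional σ) (x : A) :
    (σ (star x * x)).re ≤ ‖x‖ ^ 2 * (σ 1).re := by
  let _ : CStarAlgebra A := { }
  obtain ⟨r, hr⟩ := aux_norm_sq x
  have h := (Complex.nonneg_iff.1 (hσ r)).1
  rw [hr, map_sub, map_smul, smul_eq_mul, Complex.sub_re, Complex.re_ofReal_mul] at h
  linarith

lemma aux_one_nonneg {σ : A →L[ℂ] ℂ} (hσ : IsPositiveFunctional σ) : 0 ≤ (σ 1).re := by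
  have h1 := (Complex.nonneg_iff.1 (hσ 1)).1
  simpa using h1

lemma aux_norm_le {σ : A →L[ℂ] ℂ} (hσ : IsPositiveFunctional σ) : ‖σ‖ ≤ (σ 1).re := by
  have h0 := aux_one_nonneg hσ
  refine σ.opNorm_le_bound h0 fun x => ?_
  have h := aux_cs hσ 1 x
  have h2 := aux_sq_le hσ x
  simp only [star_one, one_mul] at h
  apply abs_le_of_sq_le_sq' _ (by positivity) |>.2
  nlinarith

lemma aux_one_le (σ : A →L[ℂ] ℂ) : (σ 1).re ≤ ‖σ‖ := by
  have := σ.le_opNorm 1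
  have h2 := Complex.re_le_norm (σ 1)
  nlinarith [norm_nonneg σ, aux_norm_one_le (A := A)]

/-- `|σ(a* b)| ≤ √δ ‖b‖ √σ(1)` in squared form. -/
lemma aux_cs' {σ : A →L[ℂ] ℂ} (hσ : IsPositiveFunctional σ) (a b : A) {δ : ℝ}
    (ha : (σ (star a * a)).re ≤ δ) :
    ‖σ (star a * b)‖ ≤ √(δ * (σ 1).re) * ‖b‖ := by
  have h1 := aux_cs hσ a b
  have h2 := aux_sq_le hσ b
  have h0 := aux_one_nonneg hσ
  have h3 := (Complex.nonneg_iff.1 (hσ a)).1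
  have hd : 0 ≤ δ := h3.trans ha
  apply abs_le_of_sq_le_sq' _ (by positivity) |>.2
  rw [mul_pow, Real.sq_sqrt (by positivity)]
  calc _ ≤ _ := h1
    _ ≤ δ * (‖b‖ ^ 2 * (σ 1).re) := by
      apply mul_le_mul ha h2 (Complex.nonneg_iff.1 (hσ b)).1 hd
    _ = _ := by ring

/-- approximate orthogonality -/
lemma aux_orth {ω ωp ωm : A →L[ℂ] ℂ} (hω : IsHermitianFunctional ω)
    (hJ : IsJordanDecomposition ω ωp ωm) {δ : ℝ} (hδ : 0 < δ) :
    ∃ h : A, IsSelfAdjoint h ∧ ‖h‖ ≤ 1 ∧ (ωp (1 - h)).re + (ωm (1 + h)).re ≤ δ := by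
  obtain ⟨hp, hm, he, hn⟩ := hJ
  have : ∃ x : A, ‖x‖ ≤ 1 ∧ ‖ω‖ - δ ≤ ‖ω x‖ := by
    by_cases h0 : ‖ω‖ - δ < 0
    · exact ⟨0, by simp, by simpa using h0.le⟩
    · obtain ⟨x, hx, hx'⟩ := ω.exists_lt_apply_of_lt_opNorm (r := ‖ω‖ - δ) (by linarith)
      exact ⟨x, hx.le, hx'.le⟩
  obtain ⟨x, hx, hxω⟩ := this
  obtain ⟨c, hc, hcx⟩ : ∃ c : ℂ, ‖c‖ = 1 ∧ c * ω x = ‖ω x‖ := by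
    obtain ⟨c, hc, h⟩ := RCLike.exists_norm_eq_mul_self (ω x)
    exact ⟨c, hc, h.symm⟩
  set y : A := c • x with hy
  have hyn : ‖y‖ ≤ 1 := by rw [hy, norm_smul, hc, one_mul]; exact hx
  have hωy : ω y = ‖ω x‖ := by rw [hy, map_smul, smul_eq_mul, hcx]
  have hωh : ω ((1 / 2 : ℂ) • (y + star y)) = ‖ω x‖ := by
    rw [map_smul, map_add, hω, hωy, Complex.conj_ofReal, smul_eq_mul]; ring
  refine ⟨(1 / 2 : ℂ) • (y + star y), ?_, ?_, ?_⟩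
  · rw [IsSelfAdjoint, star_smul, star_add, star_star, add_comm]; simp
  · rw [norm_smul]
    have := norm_add_le y (star y)
    rw [norm_star] at this
    norm_num
    linarith
  · have h1 := aux_one_le ωp
    have h2 := aux_one_le ωm
    have h3 := congrArg Complex.re hωh
    rw [he] at h3
    rw [sub_apply, Complex.sub_re, Complex.ofReal_re, ← he] at h3
    rw [map_sub, map_add, Complex.sub_re, Complex.add_re]
    linarith

lemma aux_est {σ : A →L[ℂ] ℂ} (hσ : IsPositiveFunctional σ) {s t r : A}
    (hs : star s = s) (ht : star t = t) (hr : star r = r)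
    (hst : s * s + t * t = 1) (hrs : r * r + s * s = s) {K δ : ℝ} (hK : 0 ≤ K)
    (hδ : (σ (t * t)).re ≤ δ) (hδK : δ * (σ 1).re ≤ K ^ 2) (hsn : ‖s‖ ≤ 1) (htn : ‖t‖ ≤ 1) (y : A) :
    ‖σ (s * y * s) - σ y‖ ≤ 2 * K * ‖y‖ ∧ ‖σ (t * y * t)‖ ≤ K * ‖y‖ := by
  have hsq : √(δ * (σ 1).re) ≤ K := Real.sqrt_le_iff.2 ⟨hK, hδK⟩
  have key : ∀ a b : A, (σ (star a * a)).re ≤ δ → ‖b‖ ≤ ‖y‖ → ‖σ (star a * b)‖ ≤ K * ‖y‖ := by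
    intro a b ha hb
    exact (aux_cs' hσ a b ha).trans (mul_le_mul hsq hb (norm_nonneg _) hK)
  have hmul : ∀ u v : A, ‖v‖ ≤ 1 → ‖u‖ ≤ ‖y‖ → ‖u * v‖ ≤ ‖y‖ := fun u v hv hu =>
    (norm_mul_le u v).trans (by nlinarith [norm_nonneg u, norm_nonneg v])
  have h1 : (σ (star (s - 1) * (s - 1))).re ≤ δ := by
    have e : star (s - 1) * (s - 1) = t * t - (r * r + r * r) := by
      have e1 : t * t = 1 - s * s := by rw [← hst]; abel
      have e2 : r * r = s - s * s := eq_sub_of_add_eq hrs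
      rw [star_sub, hs, star_one, e1, e2]; noncomm_ring
    have := (Complex.nonneg_iff.1 (hσ r)).1
    rw [hr] at this
    rw [e, map_sub, map_add, Complex.sub_re, Complex.add_re]
    linarith
  constructor
  · have e : σ (s * y * s) - σ y = conj (σ (star (s - 1) * (star y * s))) + σ (star (s - 1) * y) := by
      rw [← aux_herm hσ, ← map_sub, ← map_add]
      congr 1
      simp only [star_mul, star_sub, star_star, star_one, hs]
      noncomm_ring
    rw [e]
    refine (norm_add_le _ _).trans ?_
    rw [RCLike.norm_conj]
    have i1 := key (s - 1) (star y * s) h1 (hmul _ _ hsn (by rw [norm_star]))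
    have i2 := key (s - 1) y h1 le_rfl
    linarith
  · have := key t (y * t) (by rwa [ht]) (hmul _ _ htn le_rfl)
    rwa [ht, ← mul_assoc] at this

lemma aux_norm_le_one {s t : A} (hs : star s = s) (ht : star t = t) (h : s * s + t * t = 1) :
    ‖s‖ ≤ 1 := by
  let _ : CStarAlgebra A := { }
  let _ : PartialOrder A := CStarAlgebra.spectralOrder A
  have _ : StarOrderedRing A := CStarAlgebra.spectralOrderedRing A
  have h1 : star s * s ≤ 1 := by
    rw [← h, hs]
    have := star_mul_self_nonneg t
    rw [ht] at this
    exact le_add_of_nonneg_right this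
  have h2 := CStarAlgebra.norm_le_norm_of_nonneg_of_le (star_mul_self_nonneg s) h1
  rw [CStarRing.norm_star_mul_self] at h2
  nlinarith [norm_nonneg s, aux_norm_one_le (A := A)]

lemma aux_mix {φ ψ : A →L[ℂ] A} (hφ : IsElementaryUCP φ) (hψ : IsElementaryUCP ψ)
    {s t : A} (hs : star s = s) (ht : star t = t) (h : s * s + t * t = 1) :
    ∃ χ : A →L[ℂ] A, IsElementaryUCP χ ∧ ∀ x, χ x = s * φ x * s + t * ψ x * t := by
  obtain ⟨n, a, ha, hφ⟩ := hφ
  obtain ⟨m, b, hb, hψ⟩ := hψ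
  refine ⟨(ContinuousLinearMap.mulLeftRight ℂ A s s).comp φ +
    (ContinuousLinearMap.mulLeftRight ℂ A t t).comp ψ, ⟨n + m,
      Fin.append (fun i => a i * s) (fun i => b i * t), ?_, ?_⟩, ?_⟩
  · have e1 : ∑ i, star (a i * s) * (a i * s) = s * (∑ i, star (a i) * a i) * s := by
      simp only [Finset.mul_sum, Finset.sum_mul, star_mul, hs, mul_assoc]
    have e2 : ∑ i, star (b i * t) * (b i * t) = t * (∑ i, star (b i) * b i) * t := by
      simp only [Finset.mul_sum, Finset.sum_mul, star_mul, ht, mul_assoc]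
    simp only [Fin.sum_univ_add, Fin.append_left, Fin.append_right]
    rw [e1, e2, ha, hb, mul_one, mul_one, h]
  · intro x
    simp only [Fin.sum_univ_add, Fin.append_left, Fin.append_right, add_apply,
      ContinuousLinearMap.comp_apply, ContinuousLinearMap.mulLeftRight_apply, hφ, hψ]
    simp only [Finset.mul_sum, Finset.sum_mul, star_mul, hs, ht, mul_assoc]
  · intro x
    simp

lemma aux_sup {ω ωp ωm : A →L[ℂ] ℂ} (hω : IsHermitianFunctional ω)
    (hJ : IsJordanDecomposition ω ωp ωm) {ρ₁ ρ₂ : A →L[ℂ] ℂ}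
    (h1 : InWeakStarClosure (mixSet ωp) ρ₁) (h2 : InWeakStarClosure (mixSet ωm) ρ₂) :
    InWeakStarClosure (mixSet ω) (ρ₁ - ρ₂) := by
  intro ε hε n x
  obtain ⟨_, ⟨φ, hφ, rfl⟩, h1⟩ := h1 (ε / 3) (by positivity) n x
  obtain ⟨_, ⟨ψ, hψ, rfl⟩, h2⟩ := h2 (ε / 3) (by positivity) n x
  have hp := hJ.1
  have hm := hJ.2.1
  have he := hJ.2.2.1
  have hp1 := aux_one_nonneg hp
  have hm1 := aux_one_nonneg hm
  set N : ℝ := ∑ i, (‖φ (x i)‖ + ‖ψ (x i)‖) with hN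
  have hN0 : 0 ≤ N := Finset.sum_nonneg fun i _ => by positivity
  set K : ℝ := ε / (9 * (N + 1)) with hK
  have hK0 : 0 < K := by positivity
  have hKN : 3 * K * N ≤ ε / 3 := by
    rw [hK, mul_div_assoc', div_mul_eq_mul_div, div_le_iff₀ (by positivity)]
    nlinarith
  set m : ℝ := (ωp 1).re + (ωm 1).re with hmdef
  set δ : ℝ := K ^ 2 / (m + 1) with hδ
  have hδ0 : 0 < δ := by positivity
  have hδm : δ * (m + 1) = K ^ 2 := div_mul_cancel₀ _ (by positivity)
  obtain ⟨h, hsa, hn, hh⟩ := aux_orth hω hJ hδ0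
  let _ : CStarAlgebra A := { }
  obtain ⟨s, t, r, q, hs, ht, hr, hq, hs2, ht2, hst, hrs, hqt⟩ := aux_split h hsa hn
  have hts : t * t + s * s = 1 := by rw [add_comm]; exact hst
  have hpt := (Complex.nonneg_iff.1 (hp t)).1
  have hms := (Complex.nonneg_iff.1 (hm s)).1
  rw [ht] at hpt
  rw [hs] at hms
  rw [← hs2, ← ht2, map_add, map_add, Complex.add_re, Complex.add_re] at hh
  have hsn := aux_norm_le_one hs ht hst
  have htn := aux_norm_le_one ht hs hts
  obtain ⟨χ, hχ, hχe⟩ := aux_mix hφ hψ hs ht hst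
  have Ep := aux_est hp hs ht hr hst hrs hK0.le (δ := δ) (by linarith) (by nlinarith) hsn htn
  have Em := aux_est hm ht hs hq hts hqt hK0.le (δ := δ) (by linarith) (by nlinarith) htn hsn
  refine ⟨_, ⟨χ, hχ, rfl⟩, fun i => ?_⟩
  have hi : ‖φ (x i)‖ + ‖ψ (x i)‖ ≤ N :=
    Finset.single_le_sum (f := fun i => ‖φ (x i)‖ + ‖ψ (x i)‖)
      (fun i _ => by positivity) (Finset.mem_univ i)
  have a1 := (Ep (φ (x i))).1
  have a2 := (Ep (ψ (x i))).2
  have a3 := (Em (ψ (x i))).1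
  have a4 := (Em (φ (x i))).2
  have b1 := h1 i
  have b2 := h2 i
  have hKi : 3 * K * (‖φ (x i)‖ + ‖ψ (x i)‖) ≤ ε / 3 :=
    le_trans (mul_le_mul_of_nonneg_left hi (by positivity)) hKN
  simp only [ContinuousLinearMap.comp_apply] at b1 b2 ⊢
  rw [he, sub_apply, sub_apply, hχe, map_add, map_add]
  generalize φ (x i) = u at *
  generalize ψ (x i) = v at *
  have e : ρ₁ (x i) - ρ₂ (x i) -
      (ωp (s * u * s) + ωp (t * v * t) - (ωm (s * u * s) + ωm (t * v * t))) =
      (ρ₁ (x i) - ωp u) - (ρ₂ (x i) - ωm v) - (ωp (s * u * s) - ωp u) - ωp (t * v * t)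
      + (ωm (t * v * t) - ωm v) + ωm (s * u * s) := by ring
  rw [e]
  refine (norm_add_le_of_le (norm_add_le_of_le (norm_sub_le_of_le (norm_sub_le_of_le
    (norm_sub_le _ _) a1) a2) a3) a4).trans_lt ?_
  linarith

lemma aux_closure (S : Set (A →L[ℂ] ℂ)) (ρ : A →L[ℂ] ℂ) :
    InWeakStarClosure S ρ ↔
      StrongDual.toWeakDual ρ ∈ closure (StrongDual.toWeakDual '' S) := by
  constructor
  · intro h
    have hi : Topology.IsInducing (fun (f : WeakDual ℂ A) (x : A) => f x) := ⟨rfl⟩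
    rw [hi.closure_eq_preimage_closure_image, Set.mem_preimage, mem_closure_iff_nhds]
    intro o ho
    rw [nhds_pi, Filter.mem_pi'] at ho
    obtain ⟨I, t, ht, hto⟩ := ho
    have : ∀ i, ∃ ε > 0, Metric.ball (ρ i) ε ⊆ t i := fun i => Metric.mem_nhds_iff.1 (ht i)
    choose e he0 he using this
    obtain ⟨ε, hε, hεI⟩ : ∃ ε : ℝ, 0 < ε ∧ ∀ i ∈ I, ε ≤ e i := by
      rcases I.eq_empty_or_nonempty with rfl | hI
      · exact ⟨1, one_pos, by simp⟩
      · obtain ⟨j, hj, hj'⟩ := I.exists_min_image e hI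
        exact ⟨e j, he0 j, hj'⟩
    obtain ⟨σ, hσ, hσi⟩ := h ε hε I.card (fun k => (I.equivFin.symm k : A))
    refine ⟨fun x => σ x, hto ?_, ⟨_, ⟨σ, hσ, rfl⟩, rfl⟩⟩
    intro i hi
    apply he
    have := hσi (I.equivFin ⟨i, hi⟩)
    simp only [Equiv.symm_apply_apply] at this
    rw [Metric.mem_ball, dist_comm, dist_eq_norm]
    exact this.trans_le (hεI i hi)
  · intro h ε hε n x
    rw [mem_closure_iff_nhds] at h
    have hU : {f : WeakDual ℂ A | ∀ i, ‖ρ (x i) - f (x i)‖ < ε} ∈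
        nhds (StrongDual.toWeakDual ρ) := by
      have : ∀ i, ∀ᶠ f : WeakDual ℂ A in nhds (StrongDual.toWeakDual ρ),
          ‖ρ (x i) - f (x i)‖ < ε := by
        intro i
        have hc : Continuous fun f : WeakDual ℂ A => ‖ρ (x i) - f (x i)‖ :=
          (continuous_const.sub (WeakDual.eval_continuous (x i))).norm
        apply hc.continuousAt.eventually_lt continuousAt_const
        simpa using hε
      exact Filter.eventually_all.2 this
    obtain ⟨_, hf, ⟨σ, hσ, rfl⟩⟩ := h _ hU
    exact ⟨σ, hσ, hf⟩

lemma aux_pos_comp {σ : A →L[ℂ] ℂ} (hσ : IsPositiveFunctional σ) {φ : A →L[ℂ] A}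
    (hφ : IsElementaryUCP φ) : ‖σ.comp φ‖ ≤ (σ 1).re := by
  obtain ⟨n, a, ha, h⟩ := hφ
  have h1 : φ 1 = 1 := by rw [h]; simpa using ha
  have hp : IsPositiveFunctional (σ.comp φ) := by
    intro b
    rw [ContinuousLinearMap.comp_apply, h, map_sum]
    refine Finset.sum_nonneg fun i _ => ?_
    have := hσ (b * a i)
    simpa only [star_mul, mul_assoc] using this
  have := aux_norm_le hp
  rwa [ContinuousLinearMap.comp_apply, h1] at this

lemma aux_sub {ωp ωm ρ : A →L[ℂ] ℂ} (hp : IsPositiveFunctional ωp) (hm : IsPositiveFunctional ωm)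
    (h : InWeakStarClosure (mixSet (ωp - ωm)) ρ) :
    ∃ ρ₁ ρ₂ : A →L[ℂ] ℂ, InWeakStarClosure (mixSet ωp) ρ₁ ∧ InWeakStarClosure (mixSet ωm) ρ₂ ∧
        ρ = ρ₁ - ρ₂ := by
  let T : Set (WeakDual ℂ A × WeakDual ℂ A) :=
    {p | ∃ φ : A →L[ℂ] A, IsElementaryUCP φ ∧
      p = (StrongDual.toWeakDual (ωp.comp φ), StrongDual.toWeakDual (ωm.comp φ))}
  have hcomp : IsCompact (closure T) := by
    refine ((WeakDual.isCompact_closedBall (0 : StrongDual ℂ A) (ωp 1).re).prod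
      (WeakDual.isCompact_closedBall (0 : StrongDual ℂ A) (ωm 1).re)).closure_of_subset ?_
    rintro _ ⟨φ, hφ, rfl⟩
    refine ⟨?_, ?_⟩
    · change ωp.comp φ ∈ Metric.closedBall (0 : A →L[ℂ] ℂ) _
      rw [mem_closedBall_zero_iff]; exact aux_pos_comp hp hφ
    · change ωm.comp φ ∈ Metric.closedBall (0 : A →L[ℂ] ℂ) _
      rw [mem_closedBall_zero_iff]; exact aux_pos_comp hm hφ
  have hcl : IsClosed ((fun p : WeakDual ℂ A × WeakDual ℂ A => p.1 - p.2) '' closure T) :=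
    (hcomp.image (continuous_fst.sub continuous_snd)).isClosed
  have hsub : StrongDual.toWeakDual '' (mixSet (ωp - ωm)) ⊆
      (fun p : WeakDual ℂ A × WeakDual ℂ A => p.1 - p.2) '' closure T := by
    rintro _ ⟨_, ⟨φ, hφ, rfl⟩, rfl⟩
    refine ⟨_, subset_closure ⟨φ, hφ, rfl⟩, ?_⟩
    change _ = StrongDual.toWeakDual ((ωp - ωm).comp φ)
    rw [ContinuousLinearMap.sub_comp, map_sub]
  obtain ⟨⟨p₁, p₂⟩, hpT, hpe⟩ := closure_minimal hsub hcl ((aux_closure _ _).1 h)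
  refine ⟨WeakDual.toStrongDual p₁, WeakDual.toStrongDual p₂, ?_, ?_, ?_⟩
  · rw [aux_closure]
    refine closure_mono ?_ (image_closure_subset_closure_image continuous_fst ⟨_, hpT, rfl⟩)
    rintro _ ⟨_, ⟨φ, hφ, rfl⟩, rfl⟩
    exact ⟨_, ⟨φ, hφ, rfl⟩, rfl⟩
  · rw [aux_closure]
    refine closure_mono ?_ (image_closure_subset_closure_image continuous_snd ⟨_, hpT, rfl⟩)
    rintro _ ⟨_, ⟨φ, hφ, rfl⟩, rfl⟩
    exact ⟨_, ⟨φ, hφ, rfl⟩, rfl⟩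
  · exact hpe.symm

/-- **Lemma.** For a hermitian functional `ω` with Jordan decomposition
`ω = ωp - ωm`, the weak* closure of `ω ∘ E(A)` equals the set of differences of
elements of the weak* closures of `ωp ∘ E(A)` and `ωm ∘ E(A)`. -/
theorem weakStarClosure_mixSet_eq_sub_of_jordan
    (ω ωp ωm : A →L[ℂ] ℂ) (hω : IsHermitianFunctional ω)
    (hJordan : IsJordanDecomposition ω ωp ωm) :
    {ρ : A →L[ℂ] ℂ | InWeakStarClosure (mixSet ω) ρ} =
      {ρ : A →L[ℂ] ℂ | ∃ ρ₁ ρ₂ : A →L[ℂ] ℂ,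
        InWeakStarClosure (mixSet ωp) ρ₁ ∧ InWeakStarClosure (mixSet ωm) ρ₂ ∧
        ρ = ρ₁ - ρ₂} := by
  ext ρ
  constructor
  · intro h
    rw [Set.mem_ofPred_eq, hJordan.2.2.1] at h
    exact aux_sub hJordan.1 hJordan.2.1 h
  · rintro ⟨ρ₁, ρ₂, h1, h2, rfl⟩
    exact aux_sup hω hJordan h1 h2

end
end
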